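/- Let I ⊂ ℝ be a finite interval, ε > 0, L ∈ ℤ_{≥0}, and let ϑ be the Riemann–Siegel theta branch. There is a constant C depending only on I, ε and L such that for all s = σ + it with σ ∈ I and t ≥ ε, |exp((s/2 − 1/4)·log(t/(2π)) − it/2 − iπ/8 − i·ϑ(s)) − Σ_{m=0}^{L−1} u_m(σ)/(it)^m| ≤ C/t^L, where log(t/(2π)) is the real logarithm. -/

import Mathlib

open Complex Real MeasureTheory

noncomputable section

def chi (s : ℂ) : ℂ := (π : ℂ) ^ (s - 1/2) * Complex.Gamma ((1 - s)/2) / Complex.Gamma (s/2)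

def RSOmega : Set ℂ := {s : ℂ | s.im ≠ 0 ∨ (0 < s.re ∧ s.re < 1)}

def IsRSTheta (ϑ : ℂ → ℂ) : Prop :=
  DifferentiableOn ℂ ϑ RSOmega ∧ (∀ s ∈ RSOmega, Complex.exp (-2 * I * ϑ s) = chi s) ∧
    ϑ (1/2) = 0

def zetaSum (x : ℝ) (s : ℂ) : ℂ := ∑ n ∈ Finset.Icc 1 ⌊x⌋₊, (n : ℂ) ^ (-s)

def Upsilon (u τ : ℂ) : ℂ :=
  ∫ v : ℝ, Complex.exp (3 * (π:ℂ) * I / 4) *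
    (Complex.exp (-(π:ℂ) * I * τ * (1/2 + Complex.exp (3 * (π:ℂ) * I / 4) * v) ^ 2
        + 2 * (π:ℂ) * I * u * (1/2 + Complex.exp (3 * (π:ℂ) * I / 4) * v)) /
      (Complex.exp (2 * (π:ℂ) * I * (1/2 + Complex.exp (3 * (π:ℂ) * I / 4) * v)) - 1))

def G (u τ : ℂ) : ℂ :=
  τ ^ ((1:ℂ)/4) * Complex.exp (-(π:ℂ) * I * u ^ 2 / 2 + (π:ℂ) * I / 8) *
    Upsilon (τ ^ ((1:ℂ)/2) * u) τ

def Gderiv (k : ℕ) (u τ : ℂ) : ℂ := iteratedDeriv k (fun w => G w τ) u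

def hermiteH (n : ℕ) (x : ℂ) : ℂ :=
  (Nat.factorial n : ℂ) * ∑ j ∈ Finset.range (n / 2 + 1),
    (-1:ℂ) ^ j / ((Nat.factorial j : ℂ) * (Nat.factorial (n - 2*j) : ℂ)) * (2 * x) ^ (n - 2*j)

def obell (p : ℕ → ℂ) (i j : ℕ) : ℂ :=
  ∑ f ∈ (Finset.Nat.antidiagonalTuple j i).filter (fun f => ∀ l, 1 ≤ f l), ∏ l, p (f l)

def bernoulliPoly (n : ℕ) (x : ℂ) : ℂ := Polynomial.aeval x (Polynomial.bernoulli n)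

def fseq (σ : ℝ) (n : ℕ) : ℂ :=
  (bernoulliPoly (n+1) ((σ:ℂ)/2) + (-1:ℂ)^(n+1) * bernoulliPoly (n+1) ((1-(σ:ℂ))/2)) /
    (2*(n:ℂ)*((n:ℂ)+1))

def um (m : ℕ) (σ : ℝ) : ℂ :=
  (-2:ℂ)^m * ∑ k ∈ Finset.range (m+1), obell (fseq σ) m k / (Nat.factorial k : ℂ)

def seqA (j : ℕ) : ℂ := (-1:ℂ)^(j+1) / ((j:ℂ) + 2)

def seqB (j : ℕ) : ℂ := (-1:ℂ)^(j+1) / (j:ℂ)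

def dd (m r : ℕ) (σ : ℝ) : ℂ :=
  ∑ n ∈ Finset.Icc r m, (obell seqA n r / (Nat.factorial r : ℂ)) *
    ∑ k ∈ Finset.range (m - n + 1),
      (obell seqB (m - n) k / (Nat.factorial k : ℂ)) * ((σ:ℂ) - 1)^k

def qq (n ℓ : ℕ) (σ : ℝ) : ℂ :=
  ∑ m ∈ Finset.Icc (ℓ - n) (ℓ / 3), um m σ * dd (n - 2*m) (n + m - ℓ) σ

def PP (n k : ℕ) (x : ℂ) (σ : ℝ) : ℂ :=
  Complex.exp (3 * (π:ℂ) * I * (k:ℂ) / 4) * ∑ ℓ ∈ Finset.range (k/2 + 1),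
    (Nat.choose (3*n - 2*ℓ) (3*n - k) : ℂ) * (-1:ℂ)^(n + ℓ) * 2^(2*ℓ) / 2^k *
      qq n ℓ σ * hermiteH (k - 2*ℓ) (Complex.exp (-(π:ℂ) * I / 4) * x)

def IsAk (s : ℂ) (a : ℕ → ℂ) : Prop :=
  a 0 = 1 ∧ ∀ k : ℕ, ((k:ℂ) + 1) * (Real.sqrt s.im : ℂ) * a (k+1) =
    -((k:ℂ) + 1 - (s.re:ℂ)) * a k + I * (if 2 ≤ k then a (k-2) else 0)

def IsPsi (Ψ : ℂ → ℂ) : Prop :=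
  Differentiable ℂ Ψ ∧ ∀ u : ℂ, Complex.cos ((π:ℂ)*u) ≠ 0 →
    Ψ u = Complex.cos ((π:ℂ)*(u^2/2 - u - 1/8)) / Complex.cos ((π:ℂ)*u)

def wfun (s z : ℂ) : ℂ :=
  Complex.exp ((s - 1) * Complex.log (1 + z / (Real.sqrt s.im : ℂ))
    - I * (Real.sqrt s.im : ℂ) * z + I * z^2 / 2)

def rn (n : ℕ) (s z : ℂ) : ℂ :=
  wfun s z - ∑ k ∈ Finset.range n, (iteratedDeriv k (wfun s) 0 / (Nat.factorial k : ℂ)) * z^k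

def GammaOmega : Set ℂ := {s : ℂ | s.im ≠ 0 ∨ 0 < s.re}

def IsLogGamma (L : ℂ → ℂ) : Prop :=
  DifferentiableOn ℂ L GammaOmega ∧ (∀ s ∈ GammaOmega, Complex.exp (L s) = Complex.Gamma s) ∧
    L 1 = 0

def gseq (σ : ℝ) (n : ℕ) : ℂ := -(bernoulliPoly (n+1) (σ:ℂ)) / ((n:ℂ)*((n:ℂ)+1))

def gammam (m : ℕ) (σ : ℝ) : ℂ :=
  I^m * ∑ k ∈ Finset.range (m+1), obell (gseq σ) m k / (Nat.factorial k : ℂ)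

open Filter Topology Asymptotics

def acoef (n m : ℕ) : ℂ := if m < n then 0 else (-1)^(m-n) * ((m-1).choose (n-1) : ℂ)

def cc (α : ℂ) (n : ℕ) : ℂ := (-1)^(n+1) * bernoulliPoly (n+1) α / ((n:ℂ)*((n:ℂ)+1))

lemma bern_sum (m : ℕ) (α : ℂ) :
    ∑ k ∈ Finset.range (m+1), ((m+1).choose k : ℂ) * bernoulliPoly k α = ((m:ℂ)+1) * α^m := by
  have h := congrArg (Polynomial.aeval α) (Polynomial.sum_bernoulli m)
  simp only [map_sum, Polynomial.aeval_monomial, map_smul] at h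
  rw [show ((algebraMap ℚ ℂ) ((m:ℚ)+1)) = (m:ℂ)+1 by simp] at h
  rw [← h]
  apply Finset.sum_congr rfl
  intro k hk
  rw [bernoulliPoly, Algebra.smul_def]
  simp

lemma bern_zero (α : ℂ) : bernoulliPoly 0 α = 1 := by simp [bernoulliPoly]

lemma bern_one (α : ℂ) : bernoulliPoly 1 α = α - 1/2 := by
  simp [bernoulliPoly, Polynomial.bernoulli_one]

lemma pow_expansion (k M : ℕ) (h : k + 1 ≤ M) :
    (fun v : ℂ => (v/(1+v))^(k+1) - ∑ m ∈ Finset.range M, acoef (k+1) m * v^m) =O[𝓝 0]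
      fun v : ℂ => ‖v‖^M := by
  obtain ⟨M, rfl⟩ := Nat.exists_eq_add_of_le h
  have h1 := (Complex.one_div_one_sub_pow_hasFPowerSeriesOnBall_zero k).hasFPowerSeriesAt.isBigO_sub_partialSum_pow M
  have h2 : Tendsto (fun v : ℂ => -v) (𝓝 0) (𝓝 0) := by
    simpa using (continuous_neg (G := ℂ)).tendsto 0
  have h3 := h1.comp_tendsto h2
  have h4 := (isBigO_refl (fun v : ℂ => v^(k+1)) (𝓝 0)).norm_right.mul h3
  refine (h4.congr_left ?_).trans ?_
  · intro v
    simp only [Function.comp, FormalMultilinearSeries.partialSum]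
    rw [Finset.sum_range_add, Finset.sum_eq_zero (s := Finset.range (k+1)), zero_add, mul_sub, div_pow]
    · congr 1
      · simp; ring
      · rw [Finset.mul_sum, zero_add]
        apply Finset.sum_congr rfl
        intro i hi
        rw [acoef, if_neg (by omega)]
        simp
        rw [neg_pow]
        ring
    · intro i hi
      rw [acoef, if_pos (by simpa using hi), zero_mul]
  · apply IsBigO.of_bound 1
    filter_upwards with v
    simp [pow_add]

lemma coef_vanish (N m : ℕ) (hm : m < N + 2) (α : ℂ) :
    (-1:ℂ)^m/((m:ℂ)+1) + (α+1/2)*((-1)^(m+1)/(m:ℂ)) - (if m = 0 then 1 else 0)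
      - (-1)^(m+1)*α^m/(m:ℂ) + ∑ n ∈ Finset.Icc 1 N, cc α n * (acoef n m - if m = n then 1 else 0) = 0 := by
  rcases Nat.eq_zero_or_pos m with rfl | hm0
  · simp
    apply Finset.sum_eq_zero
    intro n hn
    simp at hn
    rw [acoef, if_pos (by omega), if_neg (by omega)]; simp
  · obtain ⟨p, rfl⟩ : ∃ p, m = p + 1 := ⟨m - 1, by omega⟩
    have h1 : ∑ n ∈ Finset.Icc 1 N, cc α n * (acoef n (p+1) - if p+1 = n then 1 else 0)
        = ∑ i ∈ Finset.range p, cc α (i+1) * acoef (i+1) (p+1) := by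
      have : ∑ i ∈ Finset.range p, cc α (i+1) * acoef (i+1) (p+1) =
          ∑ n ∈ Finset.Icc 1 p, cc α n * (acoef n (p+1) - if p+1 = n then 1 else 0) := by
        rw [← Finset.Ico_add_one_right_eq_Icc, Finset.sum_Ico_eq_sum_range]
        apply Finset.sum_congr (by simp)
        intro i hi
        simp at hi
        rw [if_neg (by omega), add_comm i 1, sub_zero]
      rw [this]
      symm
      apply Finset.sum_subset
      · intro i; simp; omega
      · intro i hi hi'
        simp at hi hi'
        have : i = p + 1 ∨ p + 1 < i := by omega
        rcases this with rfl | h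
        · simp [acoef]
        · rw [acoef, if_pos h, if_neg (by omega)]; simp
    rw [h1]
    have h2 := bern_sum (p+1) α
    rw [Finset.sum_range_succ', Finset.sum_range_succ'] at h2
    simp only [zero_add, bern_zero, bern_one] at h2
    have hp : (p:ℂ) + 1 ≠ 0 := by exact_mod_cast Nat.succ_ne_zero p
    have hp2 : (p:ℂ) + 1 + 1 ≠ 0 := by exact_mod_cast Nat.succ_ne_zero (p+1)
    have h3 : ∑ i ∈ Finset.range p, cc α (i+1) * acoef (i+1) (p+1)
        = (-1)^(p+1+1) / (((p:ℂ)+1)*((p:ℂ)+1+1)) *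
          ∑ k ∈ Finset.range p, ((p+1+1).choose (k+1+1) : ℂ) * bernoulliPoly (k+1+1) α := by
      rw [Finset.mul_sum]
      apply Finset.sum_congr rfl
      intro i hi
      simp at hi
      rw [acoef, if_neg (by omega), cc]
      have e1 : ((p+1+1).choose (i+1+1) : ℂ) * ((i:ℂ)+1+1) = ((p:ℂ)+1+1) * ((p+1).choose (i+1) : ℂ) := by
        exact_mod_cast (Nat.add_one_mul_choose_eq (p+1) (i+1)).symm
      have e2 : ((p+1).choose (i+1) : ℂ) * ((i:ℂ)+1) = ((p:ℂ)+1) * ((p).choose (i) : ℂ) := by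
        exact_mod_cast (Nat.add_one_mul_choose_eq p i).symm
      have hi1 : (i:ℂ) + 1 ≠ 0 := by exact_mod_cast Nat.succ_ne_zero i
      have hi2 : (i:ℂ) + 1 + 1 ≠ 0 := by exact_mod_cast Nat.succ_ne_zero (i+1)
      have e3 : ((p+1+1).choose (i+1+1) : ℂ) = ((p:ℂ)+1+1) * (((p:ℂ)+1) * ((p).choose (i) : ℂ)) / (((i:ℂ)+1)*((i:ℂ)+1+1)) := by
        rw [eq_div_iff (by positivity), ← e2]
        linear_combination ((i:ℂ)+1) * e1
      have e4 : (-1:ℂ)^(p+1+1) = (-1)^(i+1+1) * (-1)^(p+1-(i+1)) := by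
        rw [← pow_add]; congr 1; omega
      rw [e3, e4]
      push_cast
      field_simp
    rw [h3, if_neg (by omega)]
    push_cast at h2 ⊢
    simp only [Nat.choose_zero_right, Nat.choose_one_right] at h2
    push_cast at h2
    generalize (∑ k ∈ Finset.range p, ((p+1+1).choose (k+1+1) : ℂ) * bernoulliPoly (k+1+1) α) = S at h2 ⊢
    have : S = ((p:ℂ)+1+1) * α^(p+1) - ((p:ℂ)+1+1) * (α - 1/2) - 1 := by linear_combination h2
    rw [this, pow_succ (-1:ℂ) (p+1)]
    field_simp
    ring

lemma poly_vanish (N : ℕ) (α v : ℂ) (hv : v ≠ 0) :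
    (1/v) * Complex.logTaylor (N+3) v + (α+1/2) * Complex.logTaylor (N+2) v - 1
      - Complex.logTaylor (N+2) (α*v)
      + ∑ n ∈ Finset.Icc 1 N, cc α n * ((∑ m ∈ Finset.range (N+2), acoef n m * v^m) - v^n) = 0 := by
  have h1 : (1/v) * Complex.logTaylor (N+3) v = ∑ m ∈ Finset.range (N+2), (-1:ℂ)^m/((m:ℂ)+1) * v^m := by
    rw [Complex.logTaylor, Finset.sum_range_succ']
    simp only [Nat.cast_zero, div_zero, add_zero, Finset.mul_sum]
    apply Finset.sum_congr rfl
    intro i hi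
    have : (i:ℂ) + 1 ≠ 0 := by exact_mod_cast Nat.succ_ne_zero i
    push_cast
    field_simp
    ring
  have h2 : (1:ℂ) = ∑ m ∈ Finset.range (N+2), (if m = 0 then 1 else 0) * v^m := by
    simp
  have h3 : ∀ n ∈ Finset.Icc 1 N, cc α n * ((∑ m ∈ Finset.range (N+2), acoef n m * v^m) - v^n)
      = ∑ m ∈ Finset.range (N+2), cc α n * (acoef n m - if m = n then 1 else 0) * v^m := by
    intro n hn
    simp only [Finset.mem_Icc] at hn
    have : v^n = ∑ m ∈ Finset.range (N+2), (if m = n then 1 else 0) * v^m := by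
      simp [ite_mul, Finset.sum_ite_eq']
      omega
    rw [this, ← Finset.sum_sub_distrib, Finset.mul_sum]
    apply Finset.sum_congr rfl
    intro m hm
    ring
  rw [Finset.sum_congr rfl h3, Finset.sum_comm, h1]
  rw [show ∀ a b c d : ℂ, a + b - 1 - c + d =
    a + b - (∑ m ∈ Finset.range (N+2), (if m = 0 then 1 else 0) * v^m) - c + d from by
      intros; rw [← h2]]
  rw [Complex.logTaylor, Complex.logTaylor, Finset.mul_sum, ← Finset.sum_add_distrib,
    ← Finset.sum_sub_distrib, ← Finset.sum_sub_distrib, ← Finset.sum_add_distrib]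
  apply Finset.sum_eq_zero
  intro m hm
  have := coef_vanish N m (by simpa using hm) α
  rw [← Finset.sum_mul, mul_pow]
  linear_combination v^m * this

lemma bern_continuous (n : ℕ) : Continuous (bernoulliPoly n) := by
  unfold bernoulliPoly
  exact Polynomial.continuous_aeval _

lemma cc_continuous (n : ℕ) : Continuous (fun α => cc α n) := by
  unfold cc
  have := bern_continuous (n+1)
  fun_prop

lemma delta_bound (N : ℕ) (M : ℝ) : ∃ r > 0, ∃ K > 0, ∀ α v : ℂ, ‖α‖ ≤ M → v ≠ 0 → ‖v‖ < r →
    ‖(1/v+α+1/2) * Complex.log (1+v) - 1 - Complex.log (1+α*v)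
      + ∑ n ∈ Finset.Icc 1 N, cc α n * ((v/(1+v))^n - v^n)‖ ≤ K * ‖v‖^(N+2) := by
  set l : Filter (ℂ × ℂ) := 𝓟 (Metric.closedBall 0 M) ×ˢ 𝓝[≠] 0 with hl
  have hbd : ∀ g : ℂ → ℂ, Continuous g → (fun p : ℂ × ℂ => g p.1) =O[l] (fun _ => (1:ℝ)) := by
    intro g hg
    obtain ⟨C, hC⟩ := (isCompact_closedBall (0:ℂ) M).exists_bound_of_continuousOn hg.continuousOn
    apply IsBigO.of_bound C
    have : ∀ᶠ p in l, p.1 ∈ Metric.closedBall (0:ℂ) M :=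
      tendsto_fst.eventually (eventually_principal.2 (fun x hx => hx))
    filter_upwards [this] with p hp
    simpa using hC _ hp
  have hsnd : Tendsto (fun p : ℂ × ℂ => p.2) l (𝓝 0) := tendsto_snd.mono_right nhdsWithin_le_nhds
  have hne : ∀ᶠ p in l, p.2 ≠ 0 := tendsto_snd.eventually eventually_mem_nhdsWithin
  have hmul : Tendsto (fun p : ℂ × ℂ => p.1 * p.2) l (𝓝 0) := by
    have := (hbd id continuous_id).mul_isLittleO ((isLittleO_one_iff ℝ).2 hsnd)
    simpa using (isLittleO_one_iff ℝ).1 (this.congr_right (by simp) : _ =o[l] fun _ => (1:ℝ))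
  have e1 : (fun p : ℂ × ℂ => (1/p.2) * (Complex.log (1+p.2) - Complex.logTaylor (N+3) p.2)) =O[l]
      fun p => ‖p.2‖^(N+2) := by
    have := (isBigO_refl (fun p : ℂ × ℂ => 1/p.2) l).mul
      ((Complex.log_sub_logTaylor_isBigO (N+2)).comp_tendsto hsnd)
    refine this.trans ?_
    apply IsBigO.of_bound 1
    filter_upwards [hne] with p hp
    have : ‖p.2‖ ≠ 0 := by simpa using hp
    simp [pow_succ]
    apply le_of_eq
    field_simp
  have e2 : (fun p : ℂ × ℂ => (p.1+1/2) * (Complex.log (1+p.2) - Complex.logTaylor (N+2) p.2)) =O[l]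
      fun p => ‖p.2‖^(N+2) := by
    have := (hbd (fun α => α + 1/2) (by fun_prop)).mul
      ((Complex.log_sub_logTaylor_isBigO (N+1)).comp_tendsto hsnd).norm_right
    exact this.congr_right (by simp)
  have e3 : (fun p : ℂ × ℂ => (Complex.log (1+p.1*p.2) - Complex.logTaylor (N+2) (p.1*p.2))) =O[l]
      fun p => ‖p.2‖^(N+2) := by
    have h1 := ((Complex.log_sub_logTaylor_isBigO (N+1)).comp_tendsto hmul)
    have h2 := (hbd (fun α => α^(N+1+1)) (by fun_prop)).mul (isBigO_refl (fun p : ℂ × ℂ => p.2^(N+1+1)) l).norm_right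
    exact (h1.trans (h2.congr_left (fun p => by simp [mul_pow]))).congr_right (by simp)
  have e4 : ∀ n ∈ Finset.Icc 1 N, (fun p : ℂ × ℂ => cc p.1 n * ((p.2/(1+p.2))^n -
      ∑ m ∈ Finset.range (N+2), acoef n m * p.2^m)) =O[l] fun p => ‖p.2‖^(N+2) := by
    intro n hn
    simp only [Finset.mem_Icc] at hn
    obtain ⟨k, rfl⟩ : ∃ k, n = k + 1 := ⟨n-1, by omega⟩
    have h1 := (pow_expansion k (N+2) (by omega)).comp_tendsto hsnd
    have := (hbd _ (cc_continuous (k+1))).mul h1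
    exact this.congr_right (by simp)
  have e5 := ((e1.add e2).sub e3).add (IsBigO.sum e4)
  obtain ⟨K, hK, hb⟩ := e5.exists_pos
  have hb' := hb.bound
  rw [hl] at hb'
  obtain ⟨pa, hpa, pb, hpb, hp⟩ := Filter.eventually_prod_iff.1 hb'
  rw [eventually_principal] at hpa
  rw [eventually_nhdsWithin_iff, Metric.eventually_nhds_iff] at hpb
  obtain ⟨r, hr, hpb⟩ := hpb
  refine ⟨r, hr, K, hK, fun α v hα hv hvr => ?_⟩
  have := hp (hpa α (by simpa using hα)) (hpb (by simpa using hvr) hv)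
  simp only [norm_pow, norm_norm, Finset.sum_apply] at this
  refine le_trans (le_of_eq ?_) this
  congr 1
  have h0 := poly_vanish N α v hv
  simp only [mul_sub, Finset.sum_sub_distrib] at h0 ⊢
  linear_combination h0

def TT (N : ℕ) (α w : ℂ) : ℂ :=
  (w+α-1/2) * Complex.log w - w + ∑ n ∈ Finset.Icc 1 N, cc α n * (w⁻¹)^n

lemma log_mul_right (w u : ℂ) (hw : w ≠ 0) (hre : 0 ≤ w.re) (hu : 0 < u.re) :
    Complex.log (w * u) = Complex.log w + Complex.log u := by
  have hu0 : u ≠ 0 := by rintro rfl; simp at hu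
  apply Complex.log_mul hw hu0
  have h1 := abs_le.1 (Complex.abs_arg_le_pi_div_two_iff.2 hre)
  have h2 := abs_lt.1 (Complex.abs_arg_lt_pi_div_two_iff.2 (Or.inl hu))
  constructor <;> linarith [h1.1, h1.2, h2.1, h2.2]

lemma one_add_re_pos (z : ℂ) (h : ‖z‖ < 1) : 0 < (1 + z).re := by
  have := abs_le.1 (Complex.abs_re_le_norm z)
  simp; linarith [this.1]

lemma TT_step (N : ℕ) (M : ℝ) : ∃ R ≥ 1, ∃ K > 0, ∀ α w : ℂ, ‖α‖ ≤ M → 0 ≤ w.re → R ≤ ‖w‖ →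
    ‖TT N α (w+1) - TT N α w - Complex.log (w+α)‖ ≤ K * (‖w‖⁻¹)^(N+2) := by
  obtain ⟨r, hr, K, hK, h⟩ := delta_bound N M
  refine ⟨max 2 (max (2/r) (2*|M| + 1)), by simp, K, hK, fun α w hα hre hw => ?_⟩
  simp only [max_le_iff] at hw
  obtain ⟨hw1, hw2, hw3⟩ := hw
  have hwpos : 0 < ‖w‖ := by linarith
  have hw0 : w ≠ 0 := norm_pos_iff.1 hwpos
  have hv : ‖w⁻¹‖ < r := by
    rw [norm_inv, inv_lt_comm₀ hwpos hr]
    calc r⁻¹ < 2/r := by rw [inv_eq_one_div]; gcongr; norm_num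
      _ ≤ _ := hw2
  have hv1 : ‖w⁻¹‖ < 1 := by
    rw [norm_inv, inv_lt_comm₀ hwpos one_pos]; linarith
  have hαv : ‖α * w⁻¹‖ < 1 := by
    rw [norm_mul, norm_inv, ← div_eq_mul_inv, div_lt_one hwpos]
    linarith [le_abs_self M, abs_nonneg M]
  have key := h α w⁻¹ hα (inv_ne_zero hw0) hv
  rw [norm_inv] at key
  refine le_trans (le_of_eq ?_) key
  congr 1
  have h1w : 1 + w⁻¹ ≠ 0 := by
    intro h; have := one_add_re_pos _ hv1; rw [h] at this; simp at this
  have l1 : Complex.log (w+1) = Complex.log w + Complex.log (1+w⁻¹) := by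
    rw [← log_mul_right w _ hw0 hre (one_add_re_pos _ hv1)]
    congr 1; field_simp
  have l2 : Complex.log (w+α) = Complex.log w + Complex.log (1+α*w⁻¹) := by
    rw [← log_mul_right w _ hw0 hre (one_add_re_pos _ hαv)]
    congr 1; field_simp
  have l3 : w⁻¹/(1+w⁻¹) = (w+1)⁻¹ := by
    have : w * (1 + w⁻¹) = w + 1 := by field_simp
    rw [← this, mul_inv, div_eq_mul_inv]
  rw [l3]
  simp only [TT, l1, l2, mul_sub, Finset.sum_sub_distrib, one_div, inv_inv]
  ring

lemma sum_bound (N : ℕ) (y : ℝ) (hy : 2 ≤ y) (w : ℂ) (hre : w.re = 0) (him : |w.im| = y) (n : ℕ) :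
    ∑ j ∈ Finset.range n, (‖w + j‖⁻¹)^(N+2) ≤ 4 * (y⁻¹)^(N+1) := by
  have hy0 : 0 < y := by linarith
  have h1 : ∀ j : ℕ, (‖w + j‖⁻¹)^(N+2) ≤ (y⁻¹)^N * (2 * ((y + j - 1)⁻¹ - (y + (j+1 : ℕ) - 1)⁻¹)) := by
    intro j
    have hsq : ‖w + j‖^2 = y^2 + (j:ℝ)^2 := by
      rw [← Complex.normSq_eq_norm_sq, Complex.normSq_apply, ← him, sq_abs]
      simp [hre]; ring
    have hge : y ≤ ‖w + j‖ := by
      apply (pow_le_pow_iff_left₀ hy0.le (norm_nonneg _) two_ne_zero).1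
      rw [hsq]; nlinarith [sq_nonneg (j:ℝ)]
    rw [pow_add]
    have hj : (0:ℝ) ≤ j := Nat.cast_nonneg j
    gcongr
    rw [inv_pow, hsq]
    push_cast
    have e1 : 0 < y + j - 1 := by linarith
    have e2 : 0 < y + (j+1) - 1 := by linarith
    rw [inv_sub_inv e1.ne' e2.ne', inv_eq_one_div, ← mul_div_assoc]
    rw [div_le_div_iff₀ (by positivity) (by positivity)]
    nlinarith [sq_nonneg (y - j)]
  calc _ ≤ ∑ j ∈ Finset.range n, (y⁻¹)^N * (2 * ((y + j - 1)⁻¹ - (y + (j+1 : ℕ) - 1)⁻¹)) :=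
        Finset.sum_le_sum (fun j _ => h1 j)
    _ = (y⁻¹)^N * (2 * ((y + (0:ℕ) - 1)⁻¹ - (y + n - 1)⁻¹)) := by
        rw [← Finset.mul_sum, ← Finset.mul_sum, Finset.sum_range_sub' (fun j : ℕ => (y + j - 1)⁻¹)]
    _ ≤ (y⁻¹)^N * (2 * (2 * y⁻¹)) := by
        have : 0 ≤ (y + n - 1)⁻¹ := by
          apply inv_nonneg.2; have : (0:ℝ) ≤ n := Nat.cast_nonneg n; linarith
        have h2 : (y + (0:ℕ) - 1)⁻¹ ≤ 2 * y⁻¹ := by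
          simp only [Nat.cast_zero, add_zero]
          rw [← div_eq_mul_inv, inv_eq_one_div, div_le_div_iff₀ (by linarith) hy0]
          linarith
        gcongr
        linarith
    _ = _ := by ring

lemma log_sum_bound (N : ℕ) (M : ℝ) : ∃ R ≥ 2, ∃ K > 0, ∀ α w : ℂ, ‖α‖ ≤ M → w.re = 0 → R ≤ |w.im| →
    ∀ n : ℕ, ‖TT N α (w+n) - TT N α w - ∑ j ∈ Finset.range n, Complex.log (w+α+j)‖ ≤ K * (|w.im|⁻¹)^(N+1) := by
  obtain ⟨R, hR, K, hK, h⟩ := TT_step N M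
  refine ⟨max 2 R, by simp, K * 4, by positivity, fun α w hα hre hw n => ?_⟩
  simp only [max_le_iff] at hw
  have e : TT N α (w+n) - TT N α w - ∑ j ∈ Finset.range n, Complex.log (w+α+j) =
      ∑ j ∈ Finset.range n, (TT N α (w+j+1) - TT N α (w+j) - Complex.log (w+j+α)) := by
    rw [Finset.sum_sub_distrib]
    have := Finset.sum_range_sub (fun j : ℕ => TT N α (w+j)) n
    simp only [Nat.cast_add, Nat.cast_one, Nat.cast_zero, add_zero, ← add_assoc] at this
    rw [this]
    congr 1
    apply Finset.sum_congr rfl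
    intro j _
    congr 1; ring
  rw [e]
  calc _ ≤ ∑ j ∈ Finset.range n, K * (‖w + j‖⁻¹)^(N+2) := by
        apply norm_sum_le_of_le
        intro j _
        apply h α (w+j) hα
        · simp [hre]
        · have := Complex.abs_im_le_norm (w+j)
          simp at this
          linarith
    _ ≤ K * (4 * (|w.im|⁻¹)^(N+1)) := by
        rw [← Finset.mul_sum]
        have := sum_bound N _ hw.1 w hre rfl n
        gcongr
    _ = _ := by ring

lemma TT_limit (N : ℕ) (α w : ℂ) :
    Tendsto (fun n : ℕ => TT N α (w+n) - (n + w + α - 1/2) * (Real.log n : ℂ) + n) atTop (𝓝 0) := by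
  have hn : Tendsto (fun n : ℕ => (n:ℂ)⁻¹) atTop (𝓝 0) := tendsto_inv_atTop_nhds_zero_nat (𝕜 := ℂ)
  have hw : Tendsto (fun n : ℕ => w * (n:ℂ)⁻¹) atTop (𝓝 0) := by simpa using hn.const_mul w
  have h1 : Tendsto (fun n : ℕ => (n:ℂ) * Complex.log (1 + w * (n:ℂ)⁻¹)) atTop (𝓝 w) := by
    apply Complex.tendsto_nat_mul_log_one_add_of_tendsto
    apply tendsto_const_nhds.congr'
    filter_upwards [eventually_ne_atTop 0] with n hn
    have : (n:ℂ) ≠ 0 := by exact_mod_cast hn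
    field_simp
  have h2 : Tendsto (fun n : ℕ => Complex.log (1 + w * (n:ℂ)⁻¹)) atTop (𝓝 0) := by
    have := (continuousAt_clog (x := 1) (by simp)).tendsto.comp
      (by simpa using hw.const_add 1 : Tendsto (fun n : ℕ => 1 + w * (n:ℂ)⁻¹) atTop (𝓝 1))
    simpa [Function.comp_def] using this
  have h3 : Tendsto (fun n : ℕ => (w + n)⁻¹) atTop (𝓝 (0:ℂ)) := by
    have h4 : Tendsto (fun n : ℕ => (n:ℂ)⁻¹ * (1 + w * (n:ℂ)⁻¹)⁻¹) atTop (𝓝 (0 * (1 + 0)⁻¹)) :=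
      hn.mul ((hw.const_add 1).inv₀ (by simp))
    rw [zero_mul] at h4
    apply h4.congr'
    filter_upwards [eventually_ne_atTop 0] with n hn
    have : (n:ℂ) ≠ 0 := by exact_mod_cast hn
    rw [← mul_inv]
    congr 1; field_simp; ring
  have h4 : Tendsto (fun n : ℕ => ∑ k ∈ Finset.Icc 1 N, cc α k * ((w + n)⁻¹)^k) atTop (𝓝 0) := by
    have : Tendsto (fun n : ℕ => ∑ k ∈ Finset.Icc 1 N, cc α k * ((w + n)⁻¹)^k) atTop
        (𝓝 (∑ k ∈ Finset.Icc 1 N, cc α k * 0^k)) :=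
      tendsto_finsetSum _ (fun k _ => (h3.pow k).const_mul _)
    rwa [Finset.sum_eq_zero] at this
    intro k hk
    simp at hk
    rw [zero_pow (by omega), mul_zero]
  have h5 := ((h1.add (h2.const_mul (w + α - 1/2))).add h4).sub_const w
  simp only [mul_zero, add_zero, sub_self] at h5
  apply h5.congr'
  have hsm : ∀ᶠ n : ℕ in atTop, ‖w * (n:ℂ)⁻¹‖ < 1 := by
    have := hw.norm
    rw [norm_zero] at this
    exact this.eventually_lt_const one_pos
  filter_upwards [eventually_ne_atTop 0, hsm] with n hn hs
  have hn0 : (n:ℂ) ≠ 0 := by exact_mod_cast hn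
  have : Complex.log (w + n) = (Real.log n : ℂ) + Complex.log (1 + w * (n:ℂ)⁻¹) := by
    rw [Complex.ofReal_log (by positivity), Complex.ofReal_natCast,
      ← log_mul_right _ _ hn0 (by simp) (one_add_re_pos _ hs)]
    congr 1; field_simp; ring
  rw [TT, this]
  ring

def hterm (s : ℂ) (j : ℕ) : ℂ := Complex.log (s/2+j) - Complex.log ((1-s)/2+j)
    - (s-1/2) * ((Real.log j : ℂ) - (Real.log ((j:ℝ)-1) : ℂ))

lemma hterm_bound (M : ℝ) : ∃ C, ∀ᶠ j : ℕ in atTop, ∀ s : ℂ, ‖s‖ ≤ M → ‖hterm s j‖ ≤ C * (1/(j:ℝ)^2) := by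
  have hlog : ∀ (x : ℂ) (j : ℕ), 0 < j → 2 * ‖x‖ ≤ j →
      ‖Complex.log (x + j) - (Real.log j : ℂ) - x/j‖ ≤ ‖x‖^2 * (1/(j:ℝ)^2) := by
    intro x j hj hx
    have hj0 : (0:ℝ) < j := by exact_mod_cast hj
    have hjc : (j:ℂ) ≠ 0 := by exact_mod_cast hj.ne'
    have hs : ‖x/j‖ ≤ 1/2 := by
      rw [norm_div, Complex.norm_natCast, div_le_iff₀ hj0]; linarith
    have e : Complex.log (x + j) = (Real.log j : ℂ) + Complex.log (1 + x/j) := by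
      rw [Complex.ofReal_log (by positivity), Complex.ofReal_natCast,
        ← log_mul_right _ _ hjc (by simp) (one_add_re_pos _ (by linarith))]
      congr 1; field_simp; ring
    rw [e, show (Real.log j : ℂ) + Complex.log (1 + x/j) - (Real.log j : ℂ) - x/j = Complex.log (1 + x/j) - x/j by ring]
    refine (Complex.norm_log_one_add_sub_self_le (by linarith)).trans ?_
    have h1 : (1 - ‖x/j‖)⁻¹ ≤ 2 := by
      rw [inv_le_comm₀ (by linarith) two_pos]; linarith
    calc _ ≤ ‖x/j‖^2 * 2 / 2 := by gcongr
      _ = ‖x‖^2 * (1/(j:ℝ)^2) := by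
        rw [norm_div, Complex.norm_natCast]; ring
  refine ⟨(|M|/2)^2 + ((1+|M|)/2)^2 + (|M| + 1/2) * 1, ?_⟩
  obtain ⟨J, hJ⟩ := exists_nat_ge (2 + |M|)
  filter_upwards [eventually_ge_atTop J] with j hj s hs
  have hjJ : 2 + |M| ≤ (j:ℝ) := hJ.trans (by exact_mod_cast hj)
  have hM : ‖s‖ ≤ |M| := hs.trans (le_abs_self M)
  have hj2 : (2:ℝ) ≤ j := by linarith [abs_nonneg M]
  have hjn : 2 ≤ j := by exact_mod_cast hj2
  have hjc : (j:ℂ) ≠ 0 := by exact_mod_cast (by omega : j ≠ 0)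
  have n1 : ‖s/2‖ ≤ |M|/2 := by rw [norm_div]; simp; linarith
  have n2 : ‖(1-s)/2‖ ≤ (1+|M|)/2 := by
    rw [norm_div]
    have := norm_sub_le 1 s
    simp at this ⊢; linarith
  have n3 : ‖s - 1/2‖ ≤ |M| + 1/2 := by
    have := norm_sub_le s (1/2)
    have h2 : ‖(1/2:ℂ)‖ = 1/2 := by simp
    linarith
  have b1 := hlog (s/2) j (by omega) (by linarith)
  have b2 := hlog ((1-s)/2) j (by omega) (by linarith)
  have b3 := hlog (-1) j (by omega) (by simpa using hj2)
  have e3 : Complex.log (-1 + j) = (Real.log ((j:ℝ)-1) : ℂ) := by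
    rw [Complex.ofReal_log (by linarith)]; congr 1; push_cast; ring
  rw [e3] at b3
  have hj' : 0 ≤ 1/(j:ℝ)^2 := by positivity
  have key : hterm s j = (Complex.log (s/2 + j) - (Real.log j : ℂ) - s/2/j)
      - (Complex.log ((1-s)/2 + j) - (Real.log j : ℂ) - (1-s)/2/j)
      + (s-1/2) * ((Real.log ((j:ℝ)-1) : ℂ) - (Real.log j : ℂ) - (-1)/j) := by
    rw [hterm]; field_simp; ring
  rw [key]
  calc _ ≤ _ := norm_add_le _ _
    _ ≤ _ := add_le_add (norm_sub_le _ _) (norm_mul_le _ _)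
    _ ≤ (|M|/2)^2 * (1/(j:ℝ)^2) + ((1+|M|)/2)^2 * (1/(j:ℝ)^2) + (|M| + 1/2) * (1 * (1/(j:ℝ)^2)) := by
      gcongr
      · exact b1.trans (by gcongr)
      · exact b2.trans (by gcongr)
      · simpa using b3
    _ = _ := by ring

lemma hterm_unif (S : Set ℂ) (M : ℝ) (hS : ∀ s ∈ S, ‖s‖ ≤ M) :
    TendstoUniformlyOn (fun n s => ∑ j ∈ Finset.range n, hterm s j) (fun s => ∑' j, hterm s j) atTop S := by
  obtain ⟨C, hC⟩ := hterm_bound M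
  have hu : Summable (fun j : ℕ => C * (1/(j:ℝ)^2)) :=
    (Real.summable_one_div_nat_pow.2 (by norm_num)).mul_left C
  apply tendstoUniformlyOn_tsum_nat_eventually hu
  filter_upwards [hC] with j hj s hs
  exact hj s (hS s hs)

lemma hterm_tendsto (s : ℂ) :
    Tendsto (fun n => ∑ j ∈ Finset.range n, hterm s j) atTop (𝓝 (∑' j, hterm s j)) :=
  (hterm_unif {s} ‖s‖ (by simp)).tendsto_at (by simp)

lemma hterm_sum (s : ℂ) (n : ℕ) : ∑ j ∈ Finset.range (n+1), hterm s j =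
    ∑ j ∈ Finset.range (n+1), Complex.log (s/2+j) - ∑ j ∈ Finset.range (n+1), Complex.log ((1-s)/2+j)
      - (s-1/2) * (Real.log n : ℂ) := by
  simp only [hterm, Finset.sum_sub_distrib, ← Finset.mul_sum]
  congr 2
  have := Finset.sum_range_sub (fun j : ℕ => (Real.log ((j:ℝ)-1) : ℂ)) (n+1)
  simp only [Finset.sum_sub_distrib] at this
  simpa using this

lemma arg_ok (s : ℂ) (hs : 0 < s.im ∨ s = 1/2) (j : ℕ) :
    s/2 + j ∈ Complex.slitPlane ∧ (1-s)/2+j ∈ Complex.slitPlane := by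
  rcases hs with hs | rfl
  · constructor
    · right; simp; exact hs.ne'
    · right; simp; exact hs.ne'
  · have : (0:ℝ) ≤ j := Nat.cast_nonneg j
    constructor
    · left; norm_num; linarith
    · left; norm_num; linarith

lemma exp_H (s : ℂ) (hs : 0 < s.im ∨ s = 1/2) :
    Complex.exp ((s-1/2) * (Real.log π : ℂ) + ∑' j, hterm s j) = chi s := by
  have hne1 : ∀ j : ℕ, s/2 + j ≠ 0 := fun j => Complex.slitPlane_ne_zero (arg_ok s hs j).1
  have hne2 : ∀ j : ℕ, (1-s)/2 + j ≠ 0 := fun j => Complex.slitPlane_ne_zero (arg_ok s hs j).2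
  have hG : Complex.Gamma (s/2) ≠ 0 := by
    apply Complex.Gamma_ne_zero
    intro m h
    apply hne1 m; rw [h]; ring
  have h1 := (Complex.GammaSeq_tendsto_Gamma ((1-s)/2)).div (Complex.GammaSeq_tendsto_Gamma (s/2)) hG
  have h2 := (Complex.continuous_exp.tendsto _).comp ((tendsto_add_atTop_iff_nat 1).2 (hterm_tendsto s))
  have h3 : Complex.exp (∑' j, hterm s j) = Complex.Gamma ((1-s)/2) / Complex.Gamma (s/2) := by
    refine tendsto_nhds_unique h2 (h1.congr' ?_)
    filter_upwards [eventually_ne_atTop 0] with n hn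
    have hnc : (n:ℂ) ≠ 0 := by exact_mod_cast hn
    simp only [Function.comp, Pi.div_apply]
    rw [hterm_sum, Complex.exp_sub, Complex.exp_sub, Complex.exp_sum, Complex.exp_sum,
      Finset.prod_congr rfl (fun j _ => Complex.exp_log (hne1 j)),
      Finset.prod_congr rfl (fun j _ => Complex.exp_log (hne2 j))]
    have p1 : ∏ j ∈ Finset.range (n+1), (s/2+(j:ℂ)) ≠ 0 := Finset.prod_ne_zero_iff.2 (fun j _ => hne1 j)
    have p2 : ∏ j ∈ Finset.range (n+1), ((1-s)/2+(j:ℂ)) ≠ 0 := Finset.prod_ne_zero_iff.2 (fun j _ => hne2 j)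
    have hf : (n.factorial : ℂ) ≠ 0 := by exact_mod_cast n.factorial_ne_zero
    simp only [Complex.GammaSeq]
    rw [Complex.cpow_def_of_ne_zero hnc, Complex.cpow_def_of_ne_zero hnc,
      Complex.ofReal_log (by positivity), Complex.ofReal_natCast]
    have e : Complex.exp (Complex.log n * ((1-s)/2)) * Complex.exp ((s-1/2) * Complex.log n)
        = Complex.exp (Complex.log n * (s/2)) := by
      rw [← Complex.exp_add]; congr 1; ring
    rw [← e]
    have := Complex.exp_ne_zero ((s-1/2) * Complex.log n)
    have := Complex.exp_ne_zero (Complex.log n * ((1-s)/2))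
    field_simp
  rw [Complex.exp_add, h3, chi, Complex.cpow_def_of_ne_zero (by exact_mod_cast Real.pi_ne_zero),
    Complex.ofReal_log Real.pi_pos.le, mul_comm (s - 1/2)]
  ring

lemma theta_eq (ϑ : ℂ → ℂ) (hϑ : IsRSTheta ϑ) (s : ℂ) (hs : 0 < s.im) :
    -2 * I * ϑ s = (s-1/2) * (Real.log π : ℂ) + ∑' j, hterm s j := by
  set S := segment ℝ (1/2 : ℂ) s with hS
  have hSm : ∀ z ∈ S, 0 < z.im ∨ z = 1/2 := by
    intro z hz
    rw [hS, segment_eq_image'] at hz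
    obtain ⟨θ, hθ, rfl⟩ := hz
    rcases hθ.1.eq_or_lt with h | h
    · right; simp [← h]
    · left; simp; positivity
  have hsub : S ⊆ RSOmega := by
    intro z hz
    rcases hSm z hz with h | rfl
    · exact Or.inl h.ne'
    · right; norm_num
  have hb : ∀ z ∈ S, ‖z‖ ≤ max ‖(1/2:ℂ)‖ ‖s‖ := fun z hz =>
    (convexOn_norm convex_univ).le_max_of_mem_segment (Set.mem_univ _) (Set.mem_univ _) hz
  have hcont : ContinuousOn (fun z => ∑' j, hterm z j) S := by
    apply (hterm_unif S _ hb).continuousOn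
    apply Frequently.of_forall
    intro n
    apply continuousOn_finsetSum
    intro j _
    unfold hterm
    have c1 : ContinuousOn (fun z : ℂ => Complex.log (z/2+j)) S :=
      ContinuousOn.clog (by fun_prop) (fun z hz => (arg_ok z (hSm z hz) j).1)
    have c2 : ContinuousOn (fun z : ℂ => Complex.log ((1-z)/2+j)) S :=
      ContinuousOn.clog (by fun_prop) (fun z hz => (arg_ok z (hSm z hz) j).2)
    fun_prop
  have hϑc : ContinuousOn ϑ S := hϑ.1.continuousOn.mono hsub
  set φ : ℂ → ℂ := fun z => -2 * I * ϑ z - ((z-1/2) * (Real.log π : ℂ) + ∑' j, hterm z j) with hφ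
  have hφc : ContinuousOn φ S := by
    rw [hφ]; fun_prop
  have hφe : ∀ z ∈ S, ∃ n : ℤ, φ z = n * (2 * π * I) := by
    intro z hz
    apply Complex.exp_eq_one_iff.1
    rw [hφ]
    simp only
    rw [Complex.exp_sub, exp_H z (hSm z hz), hϑ.2.1 z (hsub hz)]
    apply div_self
    rw [← hϑ.2.1 z (hsub hz)]
    exact Complex.exp_ne_zero _
  have hφ0 : φ (1/2) = 0 := by
    have : ∀ j, hterm (1/2) j = 0 := by
      intro j
      rw [hterm, sub_self, zero_mul, sub_zero, show (1 - 1/2 : ℂ)/2 = 1/2/2 by norm_num, sub_self]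
    simp only [hφ, this, tsum_zero, hϑ.2.2]
    simp
  have himg : IsPreconnected ((fun z => (φ z).im / (2*π)) '' S) := by
    apply (convex_segment (1/2:ℂ) s).isPreconnected.image
    have : ContinuousOn (fun z => (φ z).im) S := Complex.continuous_im.comp_continuousOn hφc
    fun_prop
  have hval : ∀ z ∈ S, ∃ n : ℤ, (φ z).im / (2*π) = n := by
    intro z hz
    obtain ⟨n, hn⟩ := hφe z hz
    refine ⟨n, ?_⟩
    rw [hn]
    simp
  have hsS : s ∈ S := right_mem_segment ℝ _ _
  have h0S : (1/2:ℂ) ∈ S := left_mem_segment ℝ _ _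
  obtain ⟨n, hn⟩ := hφe s hsS
  have hn0 : n = 0 := by
    by_contra hne
    have hvs : (φ s).im / (2*π) = n := by
      rw [hn]; simp
    have hv0 : (φ (1/2)).im / (2*π) = 0 := by rw [hφ0]; simp
    have hord := himg.ordConnected
    have m1 : (n:ℝ) ∈ ((fun z => (φ z).im / (2*π)) '' S) := ⟨s, hsS, hvs⟩
    have m0 : (0:ℝ) ∈ ((fun z => (φ z).im / (2*π)) '' S) := ⟨1/2, h0S, hv0⟩
    rcases lt_or_gt_of_ne hne with h | h
    · have h1 : (n:ℝ) ≤ -1 := by exact_mod_cast (by omega : n ≤ -1)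
      obtain ⟨z, hz, hz2⟩ := hord.out m1 m0 (⟨by linarith, by norm_num⟩ : (-(1/2):ℝ) ∈ Set.Icc (n:ℝ) 0)
      obtain ⟨k, hk⟩ := hval z hz
      simp only [hk] at hz2
      have : (2*k : ℝ) = -1 := by linarith
      have : 2 * k = -1 := by exact_mod_cast this
      omega
    · have h1 : (1:ℝ) ≤ n := by exact_mod_cast (by omega : 1 ≤ n)
      obtain ⟨z, hz, hz2⟩ := hord.out m0 m1 (⟨by norm_num, by linarith⟩ : ((1/2):ℝ) ∈ Set.Icc 0 (n:ℝ))
      obtain ⟨k, hk⟩ := hval z hz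
      simp only [hk] at hz2
      have : (2*k : ℝ) = 1 := by linarith
      have : 2 * k = 1 := by exact_mod_cast this
      omega
  rw [hn0] at hn
  simp only [Int.cast_zero, zero_mul, hφ] at hn
  exact sub_eq_zero.1 hn

lemma stirling (N : ℕ) (M : ℝ) : ∃ R ≥ 2, ∃ K > 0, ∀ s : ℂ, ‖((s.re:ℂ)/2)‖ ≤ M → ‖((1-(s.re:ℂ))/2)‖ ≤ M →
    ∀ y : ℝ, y = s.im/2 → R ≤ y →
    ‖(∑' j, hterm s j) + TT N ((s.re:ℂ)/2) (I*y) - TT N ((1-(s.re:ℂ))/2) (-(I*y))‖ ≤ K * (y⁻¹)^(N+1) := by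
  obtain ⟨R, hR, K, hK, h⟩ := log_sum_bound N M
  refine ⟨R, hR, K + K, by positivity, fun s ha ha' y hy hyR => ?_⟩
  set a : ℂ := (s.re:ℂ)/2 with hadef
  set a' : ℂ := (1-(s.re:ℂ))/2 with ha'def
  have hs : s = (s.re:ℂ) + (s.im:ℂ) * I := (Complex.re_add_im s).symm
  have hyc : (y:ℂ) = (s.im:ℂ)/2 := by rw [hy]; push_cast; rfl
  have hy0 : 0 < y := by linarith
  have hs1 : s/2 = I*y + a := by
    rw [hyc, hadef]; nth_rewrite 1 [hs]; ring
  have hs2 : (1-s)/2 = -(I*y) + a' := by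
    rw [hyc, ha'def]; nth_rewrite 1 [hs]; ring
  have b1 := h a (I*y) ha (by simp) (by simpa [abs_of_pos hy0] using hyR)
  have b2 := h a' (-(I*y)) ha' (by simp) (by simpa [abs_of_pos hy0] using hyR)
  simp only [Complex.neg_im, abs_neg, Complex.I_mul_im, Complex.ofReal_re, abs_of_pos hy0] at b1 b2
  have l1 := (hterm_tendsto s).comp (tendsto_add_atTop_nat 1)
  have l2 := (TT_limit N a (I*y)).comp (tendsto_add_atTop_nat 1)
  have l3 := (TT_limit N a' (-(I*y))).comp (tendsto_add_atTop_nat 1)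
  have l4 : Tendsto (fun n : ℕ => (s-1/2) * ((Real.log ((n:ℝ)+1) - Real.log n : ℝ) : ℂ)) atTop (𝓝 0) := by
    have := ((Complex.continuous_ofReal.tendsto 0).comp Real.tendsto_log_nat_add_one_sub_log).const_mul (s-1/2)
    simpa [Function.comp_def] using this
  have l5 := ((l1.add_const (TT N a (I*y) - TT N a' (-(I*y)))).sub (l2.sub l3)).sub l4
  simp only [sub_zero] at l5
  rw [add_sub_assoc]
  refine le_of_tendsto l5.norm (Eventually.of_forall fun n => ?_)
  simp only [Function.comp]
  rw [hterm_sum, hs1, hs2]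
  have e : s - 1/2 = 2 * (I*y) + a - a' := by linear_combination hs1 - hs2
  have c1 := b1 (n+1)
  have c2 := b2 (n+1)
  rw [add_mul]
  refine le_trans (le_of_eq ?_) ((norm_sub_le _ _).trans (add_le_add c2 c1))
  congr 1
  rw [e]
  push_cast
  ring

lemma fseq_cc (σ : ℝ) (n : ℕ) :
    cc ((σ:ℂ)/2) n - (-1)^n * cc ((1-(σ:ℂ))/2) n = (-1)^n * (-2) * fseq σ n := by
  rw [cc, cc, fseq]
  rcases Nat.eq_zero_or_pos n with rfl | h
  · simp
  have h1 : (n:ℂ) ≠ 0 := by exact_mod_cast h.ne'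
  have h2 : (n:ℂ) + 1 ≠ 0 := by exact_mod_cast Nat.succ_ne_zero n
  field_simp
  ring

lemma log_I_mul (y : ℝ) (hy : 0 < y) : Complex.log (I*y) = Real.log y + π/2 * I := by
  rw [mul_comm, Complex.log_ofReal_mul hy Complex.I_ne_zero, Complex.log_I]

lemma log_neg_I_mul (y : ℝ) (hy : 0 < y) : Complex.log (-(I*y)) = Real.log y - π/2 * I := by
  rw [← neg_mul, mul_comm, Complex.log_ofReal_mul hy (by simp), Complex.log_neg_I]
  ring

lemma expo (N : ℕ) (A B : ℝ) (ϑ : ℂ → ℂ) (hϑ : IsRSTheta ϑ) : ∃ R ≥ 2, ∃ K > 0, ∀ s : ℂ,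
    s.re ∈ Set.Icc A B → R ≤ s.im → ∃ ρ : ℂ, ‖ρ‖ ≤ K * (s.im⁻¹)^(N+1) ∧
      (s/2 - 1/4) * (Real.log (s.im/(2*π)) : ℂ) - I*(s.im:ℂ)/2 - I*(π:ℂ)/8 - I*ϑ s =
        ∑ n ∈ Finset.Icc 1 N, fseq s.re n * (-2/(I*(s.im:ℂ)))^n + ρ := by
  set M : ℝ := 1 + |A| + |B| with hM
  obtain ⟨R, hR, K, hK, h⟩ := stirling N M
  refine ⟨2*R, by linarith, K/2 * 2^(N+1), by positivity, fun s hs ht => ?_⟩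
  have hσ : |s.re| ≤ |A| + |B| := by
    rw [abs_le]
    constructor
    · linarith [hs.1, neg_abs_le A, abs_nonneg B]
    · linarith [hs.2, le_abs_self B, abs_nonneg A]
  have hA := abs_nonneg A
  have hB := abs_nonneg B
  set y := s.im/2 with hy
  have hy0 : 0 < y := by rw [hy]; linarith
  have key := h s (by simp; linarith) (by
    have := norm_sub_le (1:ℂ) (s.re:ℂ)
    simp at this ⊢; linarith) y hy (by rw [hy]; linarith)
  refine ⟨(1/2) * ((∑' j, hterm s j) + TT N ((s.re:ℂ)/2) (I*y) - TT N ((1-(s.re:ℂ))/2) (-(I*y))), ?_, ?_⟩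
  · rw [norm_mul]
    have : (s.im)⁻¹ = y⁻¹ / 2 := by rw [hy]; field_simp
    rw [this, div_pow]
    calc _ = (1/2) * ‖(∑' j, hterm s j) + TT N ((s.re:ℂ)/2) (I*y) - TT N ((1-(s.re:ℂ))/2) (-(I*y))‖ := by simp
      _ ≤ (1/2) * (K * (y⁻¹)^(N+1)) := by gcongr
      _ = _ := by field_simp
  · have hth := theta_eq ϑ hϑ s (by linarith)
    have hyc : (s.im:ℂ) = 2 * (y:ℂ) := by rw [hy]; push_cast; ring
    have hyc0 : (y:ℂ) ≠ 0 := by exact_mod_cast hy0.ne'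
    have hlog : Real.log (s.im/(2*π)) = Real.log y - Real.log π := by
      rw [← Real.log_div hy0.ne' Real.pi_ne_zero, hy]; congr 1; field_simp
    have hsum : ∑ n ∈ Finset.Icc 1 N, cc ((s.re:ℂ)/2) n * ((I*y)⁻¹)^n
        - ∑ n ∈ Finset.Icc 1 N, cc ((1-(s.re:ℂ))/2) n * ((-(I*y))⁻¹)^n
        = -2 * ∑ n ∈ Finset.Icc 1 N, fseq s.re n * (-2/(I*(s.im:ℂ)))^n := by
      rw [← Finset.sum_sub_distrib, Finset.mul_sum]
      apply Finset.sum_congr rfl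
      intro n _
      have e1 : (-(I*(y:ℂ)))⁻¹^n = (-1)^n * ((I*(y:ℂ))⁻¹)^n := by
        rw [← mul_pow, inv_neg]; congr 1; ring
      have e2 : (-2/(I*(s.im:ℂ)))^n = (-1)^n * ((I*(y:ℂ))⁻¹)^n := by
        rw [← mul_pow, hyc]; congr 1
        have := Complex.I_ne_zero
        field_simp
      rw [e1, e2]
      linear_combination ((I*(y:ℂ))⁻¹)^n * fseq_cc s.re n
    have hsv : s = (s.re:ℂ) + 2 * (y:ℂ) * I := by
      rw [← hyc]; exact (Complex.re_add_im s).symm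
    rw [TT, TT, log_I_mul y hy0, log_neg_I_mul y hy0, hlog, hyc]
    rw [hyc] at hsum
    push_cast
    have e : (s.re:ℂ) = s - 2 * (y:ℂ) * I := by linear_combination -hsv
    generalize ∑ n ∈ Finset.Icc 1 N, cc ((s.re:ℂ)/2) n * ((I*y)⁻¹)^n = S1 at *
    generalize ∑ n ∈ Finset.Icc 1 N, cc ((1-(s.re:ℂ))/2) n * ((-(I*y))⁻¹)^n = S2 at *
    generalize ∑ n ∈ Finset.Icc 1 N, fseq s.re n * (-2/(I*(2 * (y:ℂ))))^n = S3 at *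
    rw [e]
    linear_combination (1/2) * hth - (1/2) * hsum

lemma obell_zero_of_lt (p : ℕ → ℂ) (i j : ℕ) (h : i < j) : obell p i j = 0 := by
  rw [obell, Finset.filter_eq_empty_iff.2, Finset.sum_empty]
  intro f hf hl
  rw [Finset.Nat.mem_antidiagonalTuple] at hf
  have : ∑ _l : Fin j, 1 ≤ ∑ l, f l := Finset.sum_le_sum (fun l _ => hl l)
  simp at this
  omega

lemma bell_bound (N k : ℕ) (K : ℝ) : ∃ C ≥ 0, ∀ (c : ℕ → ℂ) (x : ℂ),
    (∀ n ∈ Finset.Icc 1 N, ‖c n‖ ≤ K) → ‖x‖ ≤ 1 →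
    ‖(∑ n ∈ Finset.Icc 1 N, c n * x^n)^k - ∑ m ∈ Finset.range N, obell c m k * x^m‖ ≤ C * ‖x‖^N := by
  classical
  set P := Fintype.piFinset (fun _ : Fin k => Finset.Icc 1 N) with hP
  refine ⟨P.card * |K|^k, by positivity, fun c x hc hx => ?_⟩
  have h1 : (∑ n ∈ Finset.Icc 1 N, c n * x^n)^k = ∑ f ∈ P, (∏ l, c (f l)) * x^(∑ l, f l) := by
    rw [Finset.sum_pow']
    apply Finset.sum_congr rfl
    intro f _
    rw [Finset.prod_mul_distrib, Finset.prod_pow_eq_pow_sum]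
  have h2 : ∑ m ∈ Finset.range N, obell c m k * x^m
      = ∑ f ∈ P with ∑ l, f l < N, (∏ l, c (f l)) * x^(∑ l, f l) := by
    rw [← Finset.sum_fiberwise_of_maps_to (t := Finset.range N) (g := fun f : Fin k → ℕ => ∑ l, f l)
      (fun f hf => by simpa using (Finset.mem_filter.1 hf).2)]
    apply Finset.sum_congr rfl
    intro m hm
    simp only [Finset.mem_range] at hm
    rw [obell, Finset.sum_mul]
    apply Finset.sum_congr
    · ext f
      simp only [Finset.mem_filter, Finset.Nat.mem_antidiagonalTuple, hP, Fintype.mem_piFinset,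
        Finset.mem_Icc]
      constructor
      · rintro ⟨hf, hl⟩
        refine ⟨⟨fun l => ⟨hl l, ?_⟩, by omega⟩, hf⟩
        have : f l ≤ ∑ l, f l := Finset.single_le_sum (fun _ _ => Nat.zero_le _) (Finset.mem_univ l)
        omega
      · rintro ⟨⟨hf, _⟩, hs⟩
        exact ⟨hs, fun l => (hf l).1⟩
    · intro f hf
      rw [(Finset.mem_filter.1 hf).2]
  rw [h1, h2, ← Finset.sum_filter_add_sum_filter_not P (fun f => ∑ l, f l < N), add_sub_cancel_left]
  have h3 : ∀ f ∈ P.filter (fun f => ¬ ∑ l, f l < N), ‖(∏ l, c (f l)) * x^(∑ l, f l)‖ ≤ |K|^k * ‖x‖^N := by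
    intro f hf
    simp only [Finset.mem_filter, hP, Fintype.mem_piFinset, not_lt] at hf
    rw [norm_mul, norm_pow, norm_prod]
    have e1 : ∏ l, ‖c (f l)‖ ≤ |K|^k := by
      calc _ ≤ ∏ _l : Fin k, |K| :=
            Finset.prod_le_prod (fun _ _ => norm_nonneg _) (fun l _ => (hc _ (hf.1 l)).trans (le_abs_self K))
        _ = _ := by simp
    have e2 : ‖x‖^(∑ l, f l) ≤ ‖x‖^N := pow_le_pow_of_le_one (norm_nonneg _) hx hf.2
    gcongr
  calc _ ≤ ∑ f ∈ P.filter (fun f => ¬ ∑ l, f l < N), |K|^k * ‖x‖^N := norm_sum_le_of_le _ h3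
    _ = (P.filter (fun f => ¬ ∑ l, f l < N)).card * (|K|^k * ‖x‖^N) := by simp
    _ ≤ P.card * (|K|^k * ‖x‖^N) := by
        gcongr
        exact Finset.filter_subset _ _
    _ = _ := by ring

lemma fseq_continuous (n : ℕ) : Continuous (fun σ => fseq σ n) := by
  unfold fseq
  have := bern_continuous (n+1)
  fun_prop

lemma um_continuous (m : ℕ) : Continuous (um m) := by
  unfold um obell
  have := fseq_continuous
  fun_prop

lemma um_sum (L : ℕ) (σ : ℝ) (T : ℂ) :
    ∑ m ∈ Finset.range L, um m σ / T^m =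
      ∑ k ∈ Finset.range L, (∑ m ∈ Finset.range L, obell (fseq σ) m k * (-2/T)^m) / (k.factorial : ℂ) := by
  simp only [Finset.sum_div]
  rw [Finset.sum_comm]
  apply Finset.sum_congr rfl
  intro m hm
  simp only [Finset.mem_range] at hm
  have : ∑ k ∈ Finset.range (m+1), obell (fseq σ) m k / (k.factorial : ℂ)
      = ∑ k ∈ Finset.range L, obell (fseq σ) m k / (k.factorial : ℂ) := by
    apply Finset.sum_subset
    · intro k; simp; omega
    · intro k _ hk
      simp at hk
      rw [obell_zero_of_lt _ _ _ (by omega), zero_div]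
  rw [um, this, Finset.mul_sum, Finset.sum_div]
  apply Finset.sum_congr rfl
  intro k _
  rw [div_pow]
  ring

lemma asymp (A B : ℝ) (L : ℕ) (ϑ : ℂ → ℂ) (hϑ : IsRSTheta ϑ) :
    ∃ T ≥ 2, ∃ C : ℝ, ∀ s : ℂ, s.re ∈ Set.Icc A B → T ≤ s.im →
      ‖Complex.exp ((s/2 - 1/4) * (Real.log (s.im/(2*π)) : ℂ)
            - I*(s.im:ℂ)/2 - I*(π:ℂ)/8 - I*ϑ s)
          - ∑ m ∈ Finset.range L, um m s.re / (I*(s.im:ℂ))^m‖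
        ≤ C / s.im^L := by
  obtain ⟨R, hR, K, hK, h⟩ := expo L A B ϑ hϑ
  have hF : ∃ F ≥ 0, ∀ σ ∈ Set.Icc A B, ∀ n ∈ Finset.Icc 1 L, ‖fseq σ n‖ ≤ F := by
    choose F hF using fun n => (isCompact_Icc (a := A) (b := B)).exists_bound_of_continuousOn
      (fseq_continuous n).continuousOn
    refine ⟨∑ n ∈ Finset.Icc 1 L, |F n|, Finset.sum_nonneg (fun _ _ => abs_nonneg _), fun σ hσ n hn => ?_⟩
    exact (hF n σ hσ).trans ((le_abs_self _).trans
      (Finset.single_le_sum (f := fun n => |F n|) (fun _ _ => abs_nonneg _) hn))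
  obtain ⟨F, hF0, hF⟩ := hF
  choose Cb hCb0 hCb using fun k => bell_bound L k F
  set D := L * F with hD
  have hD0 : 0 ≤ D := by positivity
  refine ⟨R, hR, Real.exp D * (K * Real.exp K) + D^L * Real.exp D * 2^L
    + ∑ k ∈ Finset.range L, Cb k * 2^L, fun s hs ht => ?_⟩
  obtain ⟨ρ, hρ, he⟩ := h s hs ht
  have ht0 : 0 < s.im := by linarith
  set t := s.im with htd
  set x : ℂ := -2/(I*(t:ℂ)) with hx
  have hxn : ‖x‖ = 2 * t⁻¹ := by
    rw [hx, norm_div, norm_mul]; simp [abs_of_pos ht0]; rfl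
  have hti : t⁻¹ ≤ 1/2 := by rw [inv_le_comm₀ ht0 (by norm_num)]; linarith
  have hti0 : 0 < t⁻¹ := by positivity
  have hx1 : ‖x‖ ≤ 1 := by rw [hxn]; linarith
  set P := ∑ n ∈ Finset.Icc 1 L, fseq s.re n * x^n with hPd
  have hP : ‖P‖ ≤ D * ‖x‖ := by
    calc ‖P‖ ≤ ∑ n ∈ Finset.Icc 1 L, F * ‖x‖ := by
          apply norm_sum_le_of_le
          intro n hn
          rw [norm_mul, norm_pow]
          have : ‖x‖^n ≤ ‖x‖ := by
            simp only [Finset.mem_Icc] at hn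
            exact pow_le_of_le_one (norm_nonneg _) hx1 (by omega)
          have := hF s.re hs n hn
          gcongr
      _ = _ := by simp [hD]; ring
  have hPD : ‖P‖ ≤ D := hP.trans (by nlinarith)
  have hpw : (t⁻¹)^(L+1) ≤ (t⁻¹)^L := pow_le_pow_of_le_one hti0.le (by linarith) (Nat.le_succ L)
  have hρL : ‖ρ‖ ≤ K * (t⁻¹)^L := hρ.trans (mul_le_mul_of_nonneg_left hpw (by positivity))
  have hρK : ‖ρ‖ ≤ K := hρL.trans (by
    have : (t⁻¹)^L ≤ 1 := pow_le_one₀ hti0.le (by linarith)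
    nlinarith)
  rw [he, um_sum, ← hx]
  have s1 : ‖Complex.exp (P + ρ) - Complex.exp P‖ ≤ Real.exp D * (K * Real.exp K) * (t⁻¹)^L := by
    rw [Complex.exp_add, ← mul_sub_one, norm_mul]
    have h1 : ‖Complex.exp P‖ ≤ Real.exp D := (Complex.norm_exp_le_exp_norm P).trans (Real.exp_le_exp.2 hPD)
    have h2 : ‖Complex.exp ρ - 1‖ ≤ K * (t⁻¹)^L * Real.exp K := by
      have := Complex.norm_exp_sub_sum_le_norm_mul_exp ρ 1
      simp at this
      refine this.trans ?_
      gcongr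
    calc _ ≤ Real.exp D * (K * (t⁻¹)^L * Real.exp K) := by gcongr
      _ = _ := by ring
  have s2 : ‖Complex.exp P - ∑ k ∈ Finset.range L, P^k / (k.factorial:ℂ)‖ ≤ D^L * Real.exp D * 2^L * (t⁻¹)^L := by
    refine (Complex.norm_exp_sub_sum_le_norm_mul_exp P L).trans ?_
    calc _ ≤ (D * ‖x‖)^L * Real.exp D := by gcongr
      _ = _ := by rw [hxn, mul_pow, mul_pow]; ring
  have s3 : ‖∑ k ∈ Finset.range L, P^k / (k.factorial:ℂ) -
      ∑ k ∈ Finset.range L, (∑ m ∈ Finset.range L, obell (fseq s.re) m k * x^m) / (k.factorial : ℂ)‖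
      ≤ (∑ k ∈ Finset.range L, Cb k * 2^L) * (t⁻¹)^L := by
    rw [← Finset.sum_sub_distrib, Finset.sum_mul]
    apply norm_sum_le_of_le
    intro k _
    rw [← sub_div, norm_div, Complex.norm_natCast]
    have h1 := hCb k (fseq s.re) x (hF s.re hs) hx1
    have h2 : (1:ℝ) ≤ k.factorial := by exact_mod_cast k.factorial_pos
    refine (div_le_self (norm_nonneg _) h2).trans (h1.trans (le_of_eq ?_))
    rw [hxn, mul_pow]; ring
  rw [div_eq_mul_inv, ← inv_pow, add_mul, add_mul]
  refine le_trans (le_of_eq ?_) ((norm_add_le _ _).trans (add_le_add ((norm_add_le _ _).trans (add_le_add s1 s2)) s3))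
  congr 1
  ring

theorem statement18 (A B : ℝ) (ε : ℝ) (hε : 0 < ε) (L : ℕ) (ϑ : ℂ → ℂ)
    (hϑ : IsRSTheta ϑ) :
    ∃ C : ℝ, ∀ s : ℂ, s.re ∈ Set.Icc A B → ε ≤ s.im →
      ‖Complex.exp ((s/2 - 1/4) * (Real.log (s.im/(2*π)) : ℂ)
            - I*(s.im:ℂ)/2 - I*(π:ℂ)/8 - I*ϑ s)
          - ∑ m ∈ Finset.range L, um m s.re / (I*(s.im:ℂ))^m‖
        ≤ C / s.im^L := by
  obtain ⟨T, hT, C, hC⟩ := asymp A B L ϑ hϑ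
  have hcomp : IsCompact (Set.Icc A B ×ℂ Set.Icc ε T) := isCompact_Icc.reProdIm isCompact_Icc
  have him : ∀ s ∈ Set.Icc A B ×ℂ Set.Icc ε T, 0 < s.im := fun s hs => by
    have := hs.2.1
    linarith
  have hcont : ContinuousOn (fun s : ℂ => Complex.exp ((s/2 - 1/4) * (Real.log (s.im/(2*π)) : ℂ)
            - I*(s.im:ℂ)/2 - I*(π:ℂ)/8 - I*ϑ s)
          - ∑ m ∈ Finset.range L, um m s.re / (I*(s.im:ℂ))^m) (Set.Icc A B ×ℂ Set.Icc ε T) := by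
    have c1 : ContinuousOn ϑ (Set.Icc A B ×ℂ Set.Icc ε T) :=
      hϑ.1.continuousOn.mono (fun s hs => Or.inl (him s hs).ne')
    have c2 : ContinuousOn (fun s : ℂ => Real.log (s.im/(2*π))) (Set.Icc A B ×ℂ Set.Icc ε T) := by
      apply ContinuousOn.log
      · fun_prop
      · intro s hs
        have := him s hs
        positivity
    have c2' : ContinuousOn (fun s : ℂ => (Real.log (s.im/(2*π)) : ℂ)) (Set.Icc A B ×ℂ Set.Icc ε T) :=
      Complex.continuous_ofReal.comp_continuousOn c2
    apply ContinuousOn.sub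
    · fun_prop
    · apply continuousOn_finsetSum
      intro m _
      apply ContinuousOn.div
      · exact ((um_continuous m).comp Complex.continuous_re).continuousOn
      · fun_prop
      · intro s hs
        have : (s.im:ℂ) ≠ 0 := by exact_mod_cast (him s hs).ne'
        exact pow_ne_zero _ (mul_ne_zero Complex.I_ne_zero this)
  obtain ⟨C2, hC2⟩ := hcomp.exists_bound_of_continuousOn hcont
  refine ⟨max C (|C2| * T^L), fun s hs ht => ?_⟩
  have ht0 : 0 < s.im := by linarith
  rcases le_total T s.im with h | h
  · refine (hC s hs h).trans ?_
    gcongr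
    exact le_max_left _ _
  · refine (hC2 s ⟨hs, ht, h⟩).trans ?_
    rw [le_div_iff₀ (by positivity)]
    refine le_trans ?_ (le_max_right _ _)
    have := le_abs_self C2
    gcongr

end
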